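/- Let 0 < η ≤ 1/(2|Y|) and let R ⊆ X be nonempty. Let Q_η ∈ P_η(Y) attain the pseudo-capacity C_η(W_R) = max_{r∈R} D(P_r‖Q_η). Let x* ∈ X be a maximizer of x ↦ D(P_x‖Q_η) over X, and let r* ∈ R be a minimizer of r ↦ χ²(P_{x*}‖P_r) over R (the nearest neighbor of x*); assume supp(P_{x*}) ⊆ supp(P_{r*}) and η ≤ κ, where κ = min{P_{r*}(y) : y ∈ Y, P_{r*}(y) > 0}. Set χ = χ²(P_{x*}‖P_{r*}). Then C_η(W_X) − C_η(W_R) ≤ χ + √χ · √(C(W_R) · log(κ/η) + log(1/η) · log(1/κ)). -/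

import Mathlib

open scoped BigOperators Classical

/-- A probability mass function on a finite alphabet `Y`. -/
def IsPmf {Y : Type*} [Fintype Y] (p : Y → ℝ) : Prop :=
  (∀ y, 0 ≤ p y) ∧ ∑ y, p y = 1

/-- The real-valued KL sum `∑_{y : p y > 0} p y * log (p y / q y)` (natural log). -/
noncomputable def klReal {Y : Type*} [Fintype Y] (p q : Y → ℝ) : ℝ :=
  ∑ y, if 0 < p y then p y * Real.log (p y / q y) else 0

/-- KL divergence in `[0,∞] ⊆ EReal`, with the convention `D(p‖q) = ⊤`
if `supp p ⊄ supp q`. -/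
noncomputable def KL {Y : Type*} [Fintype Y] (p q : Y → ℝ) : EReal :=
  if ∀ y, 0 < p y → 0 < q y then ((klReal p q : ℝ) : EReal) else ⊤

/-- The capacity of the channel restricted to input symbols in `S`,
via the minimax (information-radius) formula, with convention `C(W_∅) = 0`. -/
noncomputable def capacity {X Y : Type*} [Fintype X] [Fintype Y]
    (P : X → Y → ℝ) (S : Set X) : EReal :=
  if S.Nonempty then
    ⨅ Q : {Q : Y → ℝ // IsPmf Q}, ⨆ x : S, KL (P (x : X)) Q.1
  else 0

/-- The pseudo-capacity: the information radius over the pseudo-simplex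
`P_η(Y) = {Q pmf : Q y ≥ η ∀ y}`, with the convention for `S = ∅` set to `0`. -/
noncomputable def pseudoCapacity {X Y : Type*} [Fintype X] [Fintype Y]
    (η : ℝ) (P : X → Y → ℝ) (S : Set X) : EReal :=
  if S.Nonempty then
    ⨅ Q : {Q : Y → ℝ // IsPmf Q ∧ ∀ y, η ≤ Q y}, ⨆ x : S, KL (P (x : X)) Q.1
  else 0

/-- The χ²-divergence `χ²(p‖q) = ∑_{y : q y > 0} (p y - q y)² / q y`. -/
noncomputable def chiSq {Y : Type*} [Fintype Y] (p q : Y → ℝ) : ℝ :=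
  ∑ y, if 0 < q y then (p y - q y) ^ 2 / q y else 0

theorem IsPmf.le_one_sub {Y : Type*} [Fintype Y] {p : Y → ℝ} (hp : IsPmf p) {y z : Y}
    (hyz : y ≠ z) : p y ≤ 1 - p z := by
  have h := Finset.sum_le_sum_of_subset_of_nonneg (f := p) (Finset.subset_univ {y, z})
    (fun i _ _ => hp.1 i)
  rw [Finset.sum_pair hyz, hp.2] at h
  linarith

theorem klReal_eq_sum {Y : Type*} [Fintype Y] {p : Y → ℝ} (hp : IsPmf p) (q : Y → ℝ) :
    klReal p q = ∑ y, p y * Real.log (p y / q y) := by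
  refine Finset.sum_congr rfl fun y _ => ?_
  split_ifs with h
  · rfl
  · simp [le_antisymm (not_lt.mp h) (hp.1 y)]

theorem chiSq_eq_sum {Y : Type*} [Fintype Y] (p : Y → ℝ) {q : Y → ℝ} (hq : IsPmf q) :
    chiSq p q = ∑ y, (p y - q y) ^ 2 / q y := by
  refine Finset.sum_congr rfl fun y _ => ?_
  split_ifs with h
  · rfl
  · simp [le_antisymm (not_lt.mp h) (hq.1 y)]

theorem chiSq_nonneg {Y : Type*} [Fintype Y] (p : Y → ℝ) {q : Y → ℝ} (hq : IsPmf q) :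
    0 ≤ chiSq p q := by
  rw [chiSq_eq_sum p hq]
  exact Finset.sum_nonneg fun y _ => div_nonneg (sq_nonneg _) (hq.1 y)

/-- Gibbs' inequality. -/
theorem klReal_nonneg {Y : Type*} [Fintype Y] {p q : Y → ℝ} (hp : IsPmf p) (hq : IsPmf q)
    (hpq : ∀ y, 0 < p y → 0 < q y) : 0 ≤ klReal p q := by
  have h : ∑ y, (p y - q y) ≤ ∑ y, p y * Real.log (p y / q y) := by
    refine Finset.sum_le_sum fun y _ => ?_
    rcases (hp.1 y).eq_or_lt with h | h
    · simpa [← h] using hq.1 y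
    · have hqy := hpq y h
      have h1 := mul_le_mul_of_nonneg_left
        (Real.one_sub_inv_le_log_of_pos (div_pos h hqy)) h.le
      have h2 : p y * (1 - (p y / q y)⁻¹) = p y - q y := by field_simp
      linarith
  rw [Finset.sum_sub_distrib, hp.2, hq.2, sub_self] at h
  rwa [klReal_eq_sum hp]

theorem klReal_le_chiSq {Y : Type*} [Fintype Y] {p q : Y → ℝ} (hp : IsPmf p) (hq : IsPmf q)
    (hpq : ∀ y, 0 < p y → 0 < q y) : klReal p q ≤ chiSq p q := by
  have h : ∑ y, p y * Real.log (p y / q y) ≤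
      ∑ y, ((p y - q y) ^ 2 / q y + (p y - q y)) := by
    refine Finset.sum_le_sum fun y _ => ?_
    rcases (hp.1 y).eq_or_lt with h | h
    · rcases (hq.1 y).eq_or_lt with h' | h'
      · simp [← h, ← h']
      · have : (0 - q y) ^ 2 / q y + (0 - q y) = 0 := by field_simp; ring
        rw [← h, this, zero_mul]
    · have hqy := hpq y h
      have h1 := mul_le_mul_of_nonneg_left
        (Real.log_le_sub_one_of_pos (div_pos h hqy)) h.le
      have h2 : p y * (p y / q y - 1) = (p y - q y) ^ 2 / q y + (p y - q y) := by
        field_simp; ring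
      linarith
  rw [Finset.sum_add_distrib, Finset.sum_sub_distrib, hp.2, hq.2, sub_self, add_zero] at h
  rwa [klReal_eq_sum hp, chiSq_eq_sum p hq]

theorem KL_eq_coe {Y : Type*} [Fintype Y] {p q : Y → ℝ} (hpq : ∀ y, 0 < p y → 0 < q y) :
    KL p q = (klReal p q : EReal) := if_pos hpq

theorem KL_nonneg {Y : Type*} [Fintype Y] {p q : Y → ℝ} (hp : IsPmf p) (hq : IsPmf q) :
    0 ≤ KL p q := by
  unfold KL
  split_ifs with h
  · exact_mod_cast klReal_nonneg hp hq h
  · exact le_top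

/-- Replacing the second argument `q` by a pmf dominating `c • q` costs at most `-log c`. -/
theorem KL_le_add_of_mul_le {Y : Type*} [Fintype Y] {p q q' : Y → ℝ} (hp : IsPmf p)
    {c : ℝ} (hc : 0 < c) (h : ∀ y, c * q y ≤ q' y) :
    KL p q' ≤ KL p q + ((-Real.log c : ℝ) : EReal) := by
  by_cases hpq : ∀ y, 0 < p y → 0 < q y
  · have hpq' : ∀ y, 0 < p y → 0 < q' y := fun y hy =>
      (mul_pos hc (hpq y hy)).trans_le (h y)
    rw [KL_eq_coe hpq, KL_eq_coe hpq']
    norm_cast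
    rw [klReal_eq_sum hp, klReal_eq_sum hp]
    have key : ∑ y, p y * Real.log (p y / q' y) ≤
        ∑ y, (p y * Real.log (p y / q y) + p y * (-Real.log c)) := by
      refine Finset.sum_le_sum fun y _ => ?_
      rcases (hp.1 y).eq_or_lt with h0 | h0
      · simp [← h0]
      · rw [← mul_add]
        refine mul_le_mul_of_nonneg_left ?_ h0.le
        have hl := Real.log_le_log (mul_pos hc (hpq y h0)) (h y)
        rw [Real.log_mul hc.ne' (hpq y h0).ne'] at hl
        rw [Real.log_div h0.ne' (hpq y h0).ne', Real.log_div h0.ne' (hpq' y h0).ne']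
        linarith
    rwa [Finset.sum_add_distrib, ← Finset.sum_mul, hp.2, one_mul] at key
  · have : KL p q = ⊤ := if_neg hpq
    rw [this, EReal.top_add_coe]
    exact le_top

theorem capacity_nonneg {X Y : Type*} [Fintype X] [Fintype Y] {P : X → Y → ℝ}
    (hP : ∀ x, IsPmf (P x)) (S : Set X) : 0 ≤ capacity P S := by
  unfold capacity
  split_ifs with h
  · obtain ⟨r, hr⟩ := h
    exact le_iInf fun Q => (KL_nonneg (hP r) Q.2).trans
      (le_iSup (fun x : S => KL (P (x : X)) Q.1) ⟨r, hr⟩)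
  · exact le_rfl

/-- The pseudo-capacity exceeds the capacity by at most `-log (1 - |Y| η)`. -/
theorem pseudoCapacity_sub_le_capacity {X Y : Type*} [Fintype X] [Fintype Y]
    {P : X → Y → ℝ} (hP : ∀ x, IsPmf (P x)) {η : ℝ} (hη : 0 ≤ η)
    (hη1 : Fintype.card Y * η < 1) {S : Set X} (hS : S.Nonempty) :
    pseudoCapacity η P S - ((-Real.log (1 - Fintype.card Y * η) : ℝ) : EReal) ≤
      capacity P S := by
  unfold capacity pseudoCapacity
  rw [if_pos hS, if_pos hS]
  refine le_iInf fun Q => EReal.sub_le_of_le_add ?_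
  set c : ℝ := 1 - Fintype.card Y * η with hc
  have hc0 : 0 < c := by linarith
  let Q' : Y → ℝ := fun y => c * Q.1 y + η
  have hQ' : IsPmf Q' ∧ ∀ y, η ≤ Q' y := by
    have hn : ∀ y, 0 ≤ c * Q.1 y := fun y => mul_nonneg hc0.le (Q.2.1 y)
    refine ⟨⟨fun y => add_nonneg (hn y) hη, ?_⟩, fun y => le_add_of_nonneg_left (hn y)⟩
    simp only [Q', Finset.sum_add_distrib, ← Finset.mul_sum, Q.2.2, Finset.sum_const,
      Finset.card_univ, nsmul_eq_mul, hc]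
    ring
  refine (iInf_le _ (⟨Q', hQ'⟩ : {Q : Y → ℝ // IsPmf Q ∧ ∀ y, η ≤ Q y})).trans ?_
  refine iSup_le fun x => (KL_le_add_of_mul_le (hP x) hc0
    (fun y => le_add_of_nonneg_right hη)).trans ?_
  gcongr
  exact le_iSup (fun x : S => KL (P (x : X)) Q.1) x

theorem klReal_sub_klReal_le {Y : Type*} [Fintype Y] {p q Q : Y → ℝ} (hp : IsPmf p)
    (hq : IsPmf q) (hpq : ∀ y, 0 < p y → 0 < q y) (hQ : ∀ y, 0 < Q y) (d : ℝ) :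
    klReal p Q - klReal q Q ≤ chiSq p q +
      √(chiSq p q) * √(∑ y, q y * (Real.log (q y / Q y) - d) ^ 2) := by
  have hsplit : klReal p Q - klReal q Q =
      klReal p q + ∑ y, (p y - q y) * (Real.log (q y / Q y) - d) := by
    have h1 : ∑ y, (p y - q y) * d = 0 := by
      rw [← Finset.sum_mul, Finset.sum_sub_distrib, hp.2, hq.2, sub_self, zero_mul]
    have h2 : ∑ y, (p y * Real.log (p y / Q y) - q y * Real.log (q y / Q y)) =
        ∑ y, (p y * Real.log (p y / q y) +
          (p y - q y) * (Real.log (q y / Q y) - d) + (p y - q y) * d) := by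
      refine Finset.sum_congr rfl fun y _ => ?_
      rcases (hp.1 y).eq_or_lt with h | h
      · rw [← h]
        ring
      · rw [Real.log_div h.ne' (hQ y).ne', Real.log_div h.ne' (hpq y h).ne',
          Real.log_div (hpq y h).ne' (hQ y).ne']
        ring
    rw [Finset.sum_add_distrib, Finset.sum_add_distrib, Finset.sum_sub_distrib, h1,
      add_zero] at h2
    rwa [klReal_eq_sum hp, klReal_eq_sum hp, klReal_eq_sum hq]
  have hcs := Real.sum_mul_le_sqrt_mul_sqrt Finset.univ
    (fun y => (p y - q y) / √(q y)) (fun y => √(q y) * (Real.log (q y / Q y) - d))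
  have e1 : ∑ y, ((p y - q y) / √(q y)) ^ 2 = chiSq p q := by
    rw [chiSq_eq_sum p hq]
    exact Finset.sum_congr rfl fun y _ => by rw [div_pow, Real.sq_sqrt (hq.1 y)]
  have e2 : ∑ y, (√(q y) * (Real.log (q y / Q y) - d)) ^ 2 =
      ∑ y, q y * (Real.log (q y / Q y) - d) ^ 2 :=
    Finset.sum_congr rfl fun y _ => by rw [mul_pow, Real.sq_sqrt (hq.1 y)]
  have e3 : ∑ y, (p y - q y) / √(q y) * (√(q y) * (Real.log (q y / Q y) - d)) =
      ∑ y, (p y - q y) * (Real.log (q y / Q y) - d) := by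
    refine Finset.sum_congr rfl fun y _ => ?_
    rcases (hq.1 y).eq_or_lt with h | h
    · have hpy : p y = 0 := by
        by_contra hne
        exact absurd (hpq y (lt_of_le_of_ne (hp.1 y) (Ne.symm hne))) h.not_lt
      simp [← h, hpy]
    · have := (Real.sqrt_pos.mpr h).ne'
      field_simp
  rw [e1, e2, e3] at hcs
  rw [hsplit]
  exact add_le_add (klReal_le_chiSq hp hq hpq) hcs

/-- The Bhatia–Davis inequality for a finite weighted sum. -/
theorem sum_mul_sub_sq_le {Y : Type*} [Fintype Y] {q : Y → ℝ} (hq : IsPmf q) {L : Y → ℝ}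
    {a b : ℝ} (ha : ∀ y, 0 < q y → a ≤ L y) (hb : ∀ y, 0 < q y → L y ≤ b) :
    ∑ y, q y * (L y - ∑ z, q z * L z) ^ 2 ≤
      (b - ∑ z, q z * L z) * ((∑ z, q z * L z) - a) := by
  set D := ∑ z, q z * L z with hD
  have h : ∑ y, q y * (L y - D) ^ 2 ≤
      ∑ y, ((a + b - 2 * D) * (q y * L y) + (D ^ 2 - a * b) * q y) := by
    refine Finset.sum_le_sum fun y _ => ?_
    rcases (hq.1 y).eq_or_lt with h | h
    · simp [← h]
    · have := mul_nonneg h.le (mul_nonneg (sub_nonneg.2 (ha y h)) (sub_nonneg.2 (hb y h)))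
      linarith
  rw [Finset.sum_add_distrib, ← Finset.mul_sum, ← Finset.mul_sum, ← hD, hq.2] at h
  linarith

theorem two_mul_mul_log_inv_le {η κ : ℝ} (hη : 0 < η) (hηκ : η ≤ κ) (hκ : κ ≤ 1 / 2) :
    2 * η * Real.log (1 / η) ≤
      (-Real.log (1 - κ) + 2 * η) * Real.log (1 / κ) := by
  have hκ0 : 0 < κ := hη.trans_le hηκ
  have hβ : κ + κ ^ 2 / 2 ≤ -Real.log (1 - κ) := by
    have h := sum_le_hasSum (Finset.range 2) (fun i _ => by positivity)
      (Real.hasSum_pow_div_log_of_abs_lt_one (x := κ) (by rw [abs_of_pos hκ0]; linarith))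
    norm_num [Finset.sum_range_succ] at h
    linarith
  have hlk : 1.69 - 2 * κ ≤ Real.log (1 / κ) := by
    have h := Real.one_sub_inv_le_log_of_pos (show 0 < 1 / (2 * κ) by positivity)
    have h2 : Real.log (1 / κ) = Real.log 2 + Real.log (1 / (2 * κ)) := by
      rw [← Real.log_mul (by norm_num) (by positivity)]
      congr 1
      field_simp
    rw [one_div, inv_inv] at h
    rw [← one_div] at h
    have := Real.log_two_gt_d9
    linarith
  have hlt : Real.log (κ / η) ≤ 0.3685 * (κ / η) := by
    have he := Real.exp_one_gt_d9
    have ht : 0 < κ / η := by positivity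
    have h := Real.log_le_sub_one_of_pos (div_pos ht (Real.exp_pos 1))
    rw [Real.log_div ht.ne' (Real.exp_pos 1).ne', Real.log_exp] at h
    have h3 : κ / η / Real.exp 1 ≤ 0.3685 * (κ / η) := by
      rw [div_le_iff₀ (Real.exp_pos 1)]
      nlinarith
    linarith
  have hle : Real.log (1 / η) = Real.log (κ / η) + Real.log (1 / κ) := by
    rw [← Real.log_mul (by positivity) (by positivity)]
    congr 1
    field_simp
  have h1 : η * Real.log (κ / η) ≤ 0.3685 * κ := by
    have := mul_le_mul_of_nonneg_left hlt hη.le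
    have e : η * (0.3685 * (κ / η)) = 0.3685 * κ := by field_simp
    linarith
  have hl0 : 0 ≤ Real.log (1 / κ) := by linarith
  have h2 : 0.737 * κ ≤ (κ + κ ^ 2 / 2) * Real.log (1 / κ) := by
    have := mul_le_mul_of_nonneg_left hlk (show 0 ≤ κ + κ ^ 2 / 2 by positivity)
    nlinarith [mul_nonneg hκ0.le (sub_nonneg.2 hκ)]
  have h3 := mul_le_mul_of_nonneg_right hβ hl0
  rw [hle]
  linarith

theorem log_sub_log_mul_log_inv_le {η κ n : ℝ} (hη : 0 < η) (hηκ : η ≤ κ) (hκ : κ ≤ 1 / 2)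
    (hn : 2 ≤ n) (hnη : n * η ≤ 1 / 2) :
    (-Real.log (1 - n * η) + Real.log (1 - (n - 1) * η)) * Real.log (1 / η) ≤
      (-Real.log (1 - κ) - Real.log (1 - n * η)) * Real.log (1 / κ) := by
  have hκ0 : 0 < κ := hη.trans_le hηκ
  have hc : 0 < 1 - n * η := by linarith
  have h1 : -Real.log (1 - n * η) + Real.log (1 - (n - 1) * η) ≤ 2 * η := by
    have hc' : 0 < 1 - (n - 1) * η := by linarith
    have h := Real.log_le_sub_one_of_pos (div_pos hc' hc)
    rw [Real.log_div hc'.ne' hc.ne'] at h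
    have : (1 - (n - 1) * η) / (1 - n * η) - 1 ≤ 2 * η := by
      rw [sub_le_iff_le_add, div_le_iff₀ hc]
      nlinarith
    linarith
  have h2 : 2 * η ≤ -Real.log (1 - n * η) := by
    have := Real.log_le_sub_one_of_pos hc
    nlinarith
  have hb : 0 ≤ Real.log (1 / η) := Real.log_nonneg (by rw [le_div_iff₀ hη]; linarith)
  have ha : 0 ≤ Real.log (1 / κ) := Real.log_nonneg (by rw [le_div_iff₀ hκ0]; linarith)
  have h3 := mul_le_mul_of_nonneg_right h1 hb
  have h4 := mul_le_mul_of_nonneg_right h2 ha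
  have h5 := two_mul_mul_log_inv_le hη hηκ hκ
  linarith

theorem sum_mul_log_sub_klReal_sq_le {Y : Type*} [Fintype Y] {q Q : Y → ℝ} (hq : IsPmf q)
    (hQ : IsPmf Q) {η κ C : ℝ} (hη : 0 < η) (hη2 : Fintype.card Y * η ≤ 1 / 2)
    (hQη : ∀ y, η ≤ Q y) (hκ : ∀ y, 0 < q y → κ ≤ q y) (hηκ : η ≤ κ)
    (hex : ∃ y z, y ≠ z ∧ 0 < q y ∧ 0 < q z) (hC0 : 0 ≤ C)
    (hC : klReal q Q + Real.log (1 - Fintype.card Y * η) ≤ C) :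
    ∑ y, q y * (Real.log (q y / Q y) - klReal q Q) ^ 2 ≤
      C * Real.log (κ / η) + Real.log (1 / η) * Real.log (1 / κ) := by
  have hκ0 : 0 < κ := hη.trans_le hηκ
  have hQ0 : ∀ y, 0 < Q y := fun y => hη.trans_le (hQη y)
  obtain ⟨u, v, huv, hu, hv⟩ := hex
  have hκ2 : κ ≤ 1 / 2 := by linarith [hq.le_one_sub huv, hκ u hu, hκ v hv]
  set n : ℝ := (Fintype.card Y : ℝ) with hn
  have hn2 : 2 ≤ n := by
    have : 1 < Fintype.card Y := Fintype.one_lt_card_iff.2 ⟨u, v, huv⟩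
    rw [hn]
    exact_mod_cast this
  have hc : 0 < 1 - n * η := by linarith
  have hc' : 0 < 1 - (n - 1) * η := by linarith
  have hqle : ∀ y, q y ≤ 1 - κ := fun y => by
    by_cases h : y = u
    · linarith [hq.le_one_sub (h ▸ huv : y ≠ v), hκ v hv]
    · linarith [hq.le_one_sub h, hκ u hu]
  have hQle : ∀ y, Q y ≤ 1 - (n - 1) * η := fun y => by
    have h1 := Finset.add_sum_erase Finset.univ Q (Finset.mem_univ y)
    have h2 := Finset.card_nsmul_le_sum (Finset.univ.erase y) Q η fun z _ => hQη z
    rw [Finset.card_erase_of_mem (Finset.mem_univ y), Finset.card_univ, nsmul_eq_mul,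
      Nat.cast_sub (Fintype.card_pos_iff.2 ⟨y⟩), Nat.cast_one, ← hn] at h2
    rw [hQ.2] at h1
    linarith
  have hvar := sum_mul_sub_sq_le hq (L := fun y => Real.log (q y / Q y))
    (a := Real.log κ - Real.log (1 - (n - 1) * η))
    (b := Real.log (1 - κ) - Real.log η)
    (fun y hy => by
      rw [Real.log_div hy.ne' (hQ0 y).ne']
      exact sub_le_sub (Real.log_le_log hκ0 (hκ y hy)) (Real.log_le_log (hQ0 y) (hQle y)))
    (fun y hy => by
      rw [Real.log_div hy.ne' (hQ0 y).ne']
      exact sub_le_sub (Real.log_le_log hy (hqle y)) (Real.log_le_log hη (hQη y)))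
  have hD0 := klReal_nonneg hq hQ fun y _ => hQ0 y
  have hDb : klReal q Q ≤ Real.log (1 - κ) - Real.log η := by
    have h : ∑ y, q y * Real.log (q y / Q y) ≤
        ∑ y, q y * (Real.log (1 - κ) - Real.log η) := by
      refine Finset.sum_le_sum fun y _ => ?_
      rcases (hq.1 y).eq_or_lt with h | h
      · simp [← h]
      · refine mul_le_mul_of_nonneg_left ?_ h.le
        rw [Real.log_div h.ne' (hQ0 y).ne']
        exact sub_le_sub (Real.log_le_log h (hqle y)) (Real.log_le_log hη (hQη y))
    rwa [← Finset.sum_mul, hq.2, one_mul, ← klReal_eq_sum hq] at h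
  rw [← klReal_eq_sum hq] at hvar
  refine hvar.trans ?_
  have hcore := log_sub_log_mul_log_inv_le hη hηκ hκ2 hn2 hη2
  have hβ : Real.log (1 - κ) ≤ 0 := Real.log_nonpos (by linarith) (by linarith)
  have ha : Real.log κ ≤ 0 := Real.log_nonpos hκ0.le (by linarith)
  have hab : Real.log η ≤ Real.log κ := Real.log_le_log hη hηκ
  rw [Real.log_div hκ0.ne' hη.ne']
  simp only [one_div, Real.log_inv] at hcore ⊢
  generalize klReal q Q = D at *
  generalize Real.log (1 - κ) = β at *
  generalize Real.log (1 - n * η) = δ at *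
  generalize Real.log (1 - (n - 1) * η) = α at *
  generalize Real.log κ = a at *
  generalize Real.log η = b at *
  have hC1 := mul_le_mul_of_nonneg_right hC (sub_nonneg.2 hab)
  have hC2 := mul_nonneg hC0 (sub_nonneg.2 hab)
  have hDβ : 0 ≤ -a * (D - β) := mul_nonneg (by linarith) (by linarith)
  rcases le_total D (-α) with h | h
  · have := mul_nonneg (sub_nonneg.2 hDb) (sub_nonneg.2 h)
    linarith
  · have := mul_nonneg (sub_nonneg.2 h) (show 0 ≤ D - β by linarith)
    linarith

/-- Lemma 1 of the paper: bound on the difference of pseudo-capacities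
via the χ²-distance of the `D(·‖Q_η)`-maximizing symbol `x*` to its nearest neighbor
`r* ∈ R`. -/
theorem pseudoCapacity_diff_le_nearest_neighbor_bound
    {X Y : Type*} [Fintype X] [Fintype Y] [Nonempty Y]
    (P : X → Y → ℝ) (hP : ∀ x, IsPmf (P x))
    (η : ℝ) (hη : 0 < η) (hη2 : η ≤ 1 / (2 * (Fintype.card Y : ℝ)))
    (R : Set X) (hR : R.Nonempty)
    (Qη : Y → ℝ) (hQη : IsPmf Qη) (hQηlb : ∀ y, η ≤ Qη y)
    (hQηatt : pseudoCapacity η P R = ⨆ r : R, KL (P (r : X)) Qη)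
    (xstar : X) (hxstar : ∀ x, KL (P x) Qη ≤ KL (P xstar) Qη)
    (rstar : X) (hrstarR : rstar ∈ R)
    (hrstarmin : ∀ r ∈ R, chiSq (P xstar) (P rstar) ≤ chiSq (P xstar) (P r))
    (hsupp : ∀ y, 0 < P xstar y → 0 < P rstar y)
    (κ : ℝ) (hκmem : ∃ y, 0 < P rstar y ∧ P rstar y = κ)
    (hκmin : ∀ y, 0 < P rstar y → κ ≤ P rstar y) (hηκ : η ≤ κ)
    (C : ℝ) (hC : capacity P R = ((C : ℝ) : EReal)) :
    pseudoCapacity η P Set.univ - pseudoCapacity η P R ≤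
      ((chiSq (P xstar) (P rstar) + Real.sqrt (chiSq (P xstar) (P rstar)) *
        Real.sqrt (C * Real.log (κ / η) + Real.log (1 / η) * Real.log (1 / κ)) : ℝ) : EReal) := by
  have hQ0 : ∀ y, 0 < Qη y := fun y => hη.trans_le (hQηlb y)
  have hp := hP xstar
  have hq := hP rstar
  have hnη : Fintype.card Y * η ≤ 1 / 2 := by
    have hpos : (0 : ℝ) < Fintype.card Y := by exact_mod_cast Fintype.card_pos
    rw [le_div_iff₀ (by positivity)] at hη2
    linarith
  have hX : pseudoCapacity η P Set.univ ≤ (klReal (P xstar) Qη : EReal) := by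
    rw [← KL_eq_coe fun y _ => hQ0 y]
    unfold pseudoCapacity
    rw [if_pos ⟨xstar, Set.mem_univ _⟩]
    exact (iInf_le _ (⟨Qη, hQη, hQηlb⟩ : {Q : Y → ℝ // IsPmf Q ∧ ∀ y, η ≤ Q y})).trans
      (iSup_le fun x => hxstar x)
  have hRle : (klReal (P rstar) Qη : EReal) ≤ pseudoCapacity η P R := by
    rw [← KL_eq_coe fun y _ => hQ0 y, hQηatt]
    exact le_iSup (fun r : R => KL (P (r : X)) Qη) ⟨rstar, hrstarR⟩
  refine (EReal.sub_le_sub hX hRle).trans ?_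
  norm_cast
  by_cases hex : ∃ y z, y ≠ z ∧ 0 < P rstar y ∧ 0 < P rstar z
  · have hC0 : 0 ≤ C := by exact_mod_cast hC ▸ capacity_nonneg hP R
    have hCD : klReal (P rstar) Qη + Real.log (1 - Fintype.card Y * η) ≤ C := by
      have h := (EReal.sub_le_sub hRle le_rfl).trans
        (pseudoCapacity_sub_le_capacity hP hη.le (by linarith) hR)
      rw [hC] at h
      norm_cast at h
      linarith
    refine (klReal_sub_klReal_le hp hq hsupp hQ0 (klReal (P rstar) Qη)).trans ?_
    gcongr
    exact sum_mul_log_sub_klReal_sq_le hq hQη hη hnη hQηlb hκmin hηκ hex hC0 hCD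
  · push Not at hex
    obtain ⟨u, hu, -⟩ := hκmem
    have key : ∀ p : Y → ℝ, IsPmf p → (∀ y, 0 < p y → 0 < P rstar y) →
        p = Pi.single u 1 := fun p hp hpq => by
      have hz : ∀ y, y ≠ u → p y = 0 := fun y hy => le_antisymm
        (not_lt.1 fun h => absurd hu (not_lt.2 (hex y u hy (hpq y h)))) (hp.1 y)
      funext y
      by_cases hy : y = u
      · subst hy
        rw [Pi.single_eq_same, ← hp.2, Finset.sum_eq_single y (fun z _ h => hz z h) (by simp)]
      · rw [hz y hy, Pi.single_eq_of_ne hy]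
    have hpq : P xstar = P rstar :=
      (key _ hp hsupp).trans (key _ hq fun _ h => h).symm
    rw [hpq, sub_self]
    exact add_nonneg (chiSq_nonneg _ hq) (by positivity)
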